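/- Correctness of the maximum-revisit-time bound: Let T ≥ 1 be an integer, let y : {1,…,T} → {0,1}, and let ω : {1,…,T} → ℝ satisfy ω_t ≥ 0 for all t, ω_1 = 1 − y_1, ω_t ≤ T(1 − y_t) for all t, and, for all t ≥ 2, ω_t − ω_{t−1} ≤ 1 and ω_t − ω_{t−1} ≥ 1 − T·y_t. Then a real number Z satisfies ω_t ≤ Z for all t ∈ {1,…,T} if and only if Z is at least the length of the longest run of consecutive zeros in y. Consequently, the minimum feasible value of Z equals the maximum revisit time of the timeline y. -/

import Mathlib

/-- The length of the maximal run of zeros of the timeline `y` ending at time step `t`: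
the largest `k ≥ 0` (necessarily `k ≤ t`) such that `y s = 0` for all `s` with
`t - k + 1 ≤ s ≤ t`. -/
noncomputable def zeroRunEndingAt (y : ℕ → ℝ) (t : ℕ) : ℕ :=
  sSup {k : ℕ | k ≤ t ∧ ∀ s : ℕ, t - k < s → s ≤ t → y s = 0}

/-- The maximum revisit time of the timeline `y` on `{1,…,T}`: the length of the
longest run of consecutive zeros of `y`. -/
noncomputable def maxRevisitTime (T : ℕ) (y : ℕ → ℝ) : ℕ :=
  (Finset.Icc 1 T).sup (zeroRunEndingAt y)

theorem zeroRunEndingAt_isGreatest (y : ℕ → ℝ) (t : ℕ) :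
    IsGreatest {k : ℕ | k ≤ t ∧ ∀ s : ℕ, t - k < s → s ≤ t → y s = 0}
      (zeroRunEndingAt y t) := by
  have hbdd : BddAbove {k : ℕ | k ≤ t ∧ ∀ s : ℕ, t - k < s → s ≤ t → y s = 0} :=
    ⟨t, fun _ hk => hk.1⟩
  refine ⟨Nat.sSup_mem ⟨0, Nat.zero_le t, fun s h₁ h₂ => ?_⟩ hbdd, fun k hk => le_csSup hbdd hk⟩
  omega

theorem zeroRunEndingAt_zero (y : ℕ → ℝ) : zeroRunEndingAt y 0 = 0 :=
  Nat.le_zero.mp (zeroRunEndingAt_isGreatest y 0).1.1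

theorem zeroRunEndingAt_eq_zero {y : ℕ → ℝ} {t : ℕ} (h : y t ≠ 0) :
    zeroRunEndingAt y t = 0 := by
  obtain ⟨hle, hz⟩ := (zeroRunEndingAt_isGreatest y t).1
  by_contra hne
  exact h (hz t (by omega) le_rfl)

theorem zeroRunEndingAt_succ {y : ℕ → ℝ} {t : ℕ} (h : y (t + 1) = 0) :
    zeroRunEndingAt y (t + 1) = zeroRunEndingAt y t + 1 := by
  obtain ⟨⟨hle, hz⟩, hub⟩ := zeroRunEndingAt_isGreatest y t
  obtain ⟨⟨hle', hz'⟩, hub'⟩ := zeroRunEndingAt_isGreatest y (t + 1)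
  apply le_antisymm
  · have : zeroRunEndingAt y (t + 1) - 1 ≤ zeroRunEndingAt y t :=
      hub ⟨by omega, fun s h₁ h₂ => hz' s (by omega) (by omega)⟩
    omega
  · refine hub' ⟨by omega, fun s h₁ h₂ => ?_⟩
    rcases Nat.lt_or_ge t s with hs | hs
    · rwa [show s = t + 1 by omega]
    · exact hz s (by omega) hs

/-- **Correctness of the maximum-revisit-time bound.** Under the gap-counter
constraints of the MMRT formulation, a real `Z` satisfies `ω t ≤ Z` for all
`t ∈ {1,…,T}` iff `Z` is at least the length of the longest run of consecutive zeros
in `y`; consequently, the minimum feasible value of `Z` equals the maximum revisit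
time of `y`. -/
theorem mmrt_bound_correct
    (T : ℕ) (hT : 1 ≤ T) (y ω : ℕ → ℝ)
    (hy : ∀ t ∈ Finset.Icc 1 T, y t = 0 ∨ y t = 1)
    (hω_nonneg : ∀ t ∈ Finset.Icc 1 T, 0 ≤ ω t)
    (hω_init : ω 1 = 1 - y 1)
    (hω_ub : ∀ t ∈ Finset.Icc 1 T, ω t ≤ (T : ℝ) * (1 - y t))
    (hω_inc : ∀ t ∈ Finset.Icc 2 T, ω t - ω (t - 1) ≤ 1)
    (hω_lb : ∀ t ∈ Finset.Icc 2 T, ω t - ω (t - 1) ≥ 1 - (T : ℝ) * y t) :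
    (∀ Z : ℝ, (∀ t ∈ Finset.Icc 1 T, ω t ≤ Z) ↔ (maxRevisitTime T y : ℝ) ≤ Z) ∧
    IsLeast {Z : ℝ | ∀ t ∈ Finset.Icc 1 T, ω t ≤ Z} (maxRevisitTime T y : ℝ) := by
  have key : ∀ t, 1 ≤ t → t ≤ T → ω t = zeroRunEndingAt y t := by
    intro t ht
    induction t, ht using Nat.le_induction with
    | base =>
      intro _
      rcases hy 1 (Finset.mem_Icc.mpr ⟨le_rfl, hT⟩) with h | h
      · rw [hω_init, zeroRunEndingAt_succ (t := 0) h, zeroRunEndingAt_zero, h]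
        norm_num
      · rw [hω_init, zeroRunEndingAt_eq_zero (by simp [h]), h]
        norm_num
    | succ t ht ih =>
      intro htT
      have hmem : t + 1 ∈ Finset.Icc 1 T := Finset.mem_Icc.mpr ⟨by omega, htT⟩
      have hmem₂ : t + 1 ∈ Finset.Icc 2 T := Finset.mem_Icc.mpr ⟨by omega, htT⟩
      rcases hy (t + 1) hmem with h | h
      · have hinc := hω_inc _ hmem₂
        have hlb := hω_lb _ hmem₂
        rw [Nat.add_sub_cancel, ih (by omega)] at hinc hlb
        rw [h] at hlb
        rw [zeroRunEndingAt_succ h]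
        push_cast
        linarith
      · have hub := hω_ub _ hmem
        have hnonneg := hω_nonneg _ hmem
        rw [h] at hub
        rw [zeroRunEndingAt_eq_zero (by simp [h])]
        push_cast
        linarith
  have hiff : ∀ Z : ℝ, (∀ t ∈ Finset.Icc 1 T, ω t ≤ Z) ↔ (maxRevisitTime T y : ℝ) ≤ Z := by
    intro Z
    constructor
    · intro hZ
      obtain ⟨t, ht, hmax⟩ := Finset.exists_mem_eq_sup (Finset.Icc 1 T)
        ⟨1, Finset.mem_Icc.mpr ⟨le_rfl, hT⟩⟩ (zeroRunEndingAt y)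
      have hm := Finset.mem_Icc.mp ht
      rw [maxRevisitTime, hmax, ← key t hm.1 hm.2]
      exact hZ t ht
    · intro hZ t ht
      have hm := Finset.mem_Icc.mp ht
      rw [key t hm.1 hm.2]
      exact (Nat.cast_le.mpr (Finset.le_sup (f := zeroRunEndingAt y) ht)).trans hZ
  exact ⟨hiff, (hiff _).mpr le_rfl, fun Z hZ => (hiff Z).mp hZ⟩
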